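/- Let X and Y be topological spaces and f : X → Y a surjective local homeomorphism. Let Γ be a group acting on X by homeomorphisms such that: (i) f(γ·x) = f(x) for all γ ∈ Γ and x ∈ X; (ii) the action is transitive on each fiber of f, i.e. whenever f(x) = f(x') there exists γ ∈ Γ with γ·x = x'; (iii) the action is free; and (iv) the action is properly discontinuous. Then f is a covering map. -/

import Mathlib

open Pointwise

/-- A surjective local homeomorphism `f : X → Y` that is invariant under a
free, properly discontinuous action of a group `Γ` by homeomorphisms which is
transitive on each fiber of `f` is a covering map. -/
theorem stmt_4 {X Y : Type*} [TopologicalSpace X] [TopologicalSpace Y]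
    (f : X → Y) (hsurj : Function.Surjective f) (hloc : IsLocalHomeomorph f)
    (Γ : Type*) [Group Γ] [MulAction Γ X]
    (hcont : ∀ γ : Γ, Continuous fun x : X => γ • x)
    (hinv : ∀ (γ : Γ) (x : X), f (γ • x) = f x)
    (htrans : ∀ x x' : X, f x = f x' → ∃ γ : Γ, γ • x = x')
    (hfree : ∀ (γ : Γ) (x : X), γ • x = x → γ = 1)
    (hproper : ∀ K L : Set X, IsCompact K → IsCompact L →
      {γ : Γ | (γ • K) ∩ L ≠ ∅}.Finite) :
    IsCoveringMap f := by
  have hquot : IsQuotientCoveringMap f Γ :=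
    { hloc.isOpenMap.isQuotientMap hloc.continuous hsurj with
      continuous_const_smul := hcont
      apply_eq_iff_mem_orbit := fun {x x'} =>
        ⟨fun h => htrans x' x h.symm, by rintro ⟨γ, rfl⟩; exact hinv γ x'⟩
      disjoint := fun x => by
        obtain ⟨e, hx, rfl⟩ := hloc x
        refine ⟨e.source, e.open_source.mem_nhds hx, ?_⟩
        rintro γ ⟨_, ⟨x', hx', rfl⟩, hγx'⟩
        exact hfree γ x' (e.injOn hγx' hx' (hinv γ x')) }
  exact hquot.isCoveringMap
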